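/- arXiv:2306.12117 — 8 statements merged into one kernel-verified Lean document; each statement's English description precedes it below -/
import Mathlib

section
/- Let Y be a real-valued random variable with probability density function f_Y, let τ∈(0,1), δ>0 and ν_τ∈ℝ, and suppose τ·f_Y(ν_τ+x) = (1−τ)·f_Y(ν_τ−x) for almost every x∈(0,δ). Then τ·E[(Y−ν_τ)·1(ν_τ ≤ Y ≤ ν_τ+δ)] = (1−τ)·E[(ν_τ−Y)·1(ν_τ−δ ≤ Y ≤ ν_τ)], i.e. the doubly truncated expected gain and expected loss over the window stand in the ratio (1−τ)/τ. -/
open MeasureTheory Set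

/-- If `Y` has pdf `f`, `τ ∈ (0,1)`, `δ > 0`, and
`τ·f(ν+x) = (1−τ)·f(ν−x)` for a.e. `x ∈ (0,δ)`, then
`τ·E[(Y−ν)·1(ν ≤ Y ≤ ν+δ)] = (1−τ)·E[(ν−Y)·1(ν−δ ≤ Y ≤ ν)]`,
expectations being integrals against the density `f`. -/
theorem stmt3 (f : ℝ → ℝ) (hf_nonneg : ∀ x, 0 ≤ f x) (hf_int : Integrable f)
    (hf_one : ∫ x, f x = 1) (τ δ ν : ℝ) (hτ : τ ∈ Set.Ioo (0:ℝ) 1) (hδ : 0 < δ)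
    (hratio : ∀ᵐ x : ℝ, x ∈ Set.Ioo 0 δ → τ * f (ν + x) = (1 - τ) * f (ν - x)) :
    τ * ∫ x in Set.Icc ν (ν + δ), (x - ν) * f x
      = (1 - τ) * ∫ x in Set.Icc (ν - δ) ν, (ν - x) * f x := by
  have gain : ∫ x in Set.Icc ν (ν + δ), (x - ν) * f x = ∫ x in (0:ℝ)..δ, x * f (ν + x) := by
    rw [integral_Icc_eq_integral_Ioc, ← intervalIntegral.integral_of_le (by linarith)]
    simpa using
      (intervalIntegral.integral_comp_add_left (a := 0) (b := δ) (fun x => (x - ν) * f x) ν).symm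
  have loss : ∫ x in Set.Icc (ν - δ) ν, (ν - x) * f x = ∫ x in (0:ℝ)..δ, x * f (ν - x) := by
    rw [integral_Icc_eq_integral_Ioc, ← intervalIntegral.integral_of_le (by linarith)]
    simpa using
      (intervalIntegral.integral_comp_sub_left (a := 0) (b := δ) (fun x => (ν - x) * f x) ν).symm
  rw [gain, loss, ← intervalIntegral.integral_const_mul, ← intervalIntegral.integral_const_mul]
  apply intervalIntegral.integral_congr_ae
  filter_upwards [hratio, Measure.ae_ne volume δ] with x hx hne hmem
  rw [uIoc_of_le hδ.le] at hmem
  linear_combination x * hx ⟨hmem.1, lt_of_le_of_ne hmem.2 hne⟩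
end

section
/- Let Y be a real-valued random variable with probability density function f_Y, let τ∈(0,1) and ν_τ∈ℝ, and suppose τ·f_Y(ν_τ+x) = (1−τ)·f_Y(ν_τ−x) for almost every x>0. Then τ·P(Y ≥ ν_τ) = (1−τ)·P(Y ≤ ν_τ); in particular P(Y ≤ ν_τ) = τ, so ν_τ is the τ-th quantile of Y. -/
open MeasureTheory Set

theorem integral_Ioi_add_left_eq (f : ℝ → ℝ) (c : ℝ) :
    ∫ x in Ioi (0 : ℝ), f (c + x) = ∫ x in Ici c, f x := by
  rw [integral_Ici_eq_integral_Ioi]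
  have h := (measurePreserving_add_left volume c).setIntegral_preimage_emb
    (MeasurableEquiv.addLeft c).measurableEmbedding f (Ioi c)
  simpa using h

theorem integral_Ioi_sub_left_eq (f : ℝ → ℝ) (c : ℝ) :
    ∫ x in Ioi (0 : ℝ), f (c - x) = ∫ x in Iic c, f x := by
  rw [integral_Iic_eq_integral_Iio]
  have h := (Measure.measurePreserving_sub_left volume c).setIntegral_preimage_emb
    (MeasurableEquiv.subLeft c).measurableEmbedding f (Iio c)
  simpa using h


/-- If `Y` has pdf `f`, `τ ∈ (0,1)`, and `τ·f(ν+x) = (1−τ)·f(ν−x)` for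
a.e. `x > 0`, then `τ·P(Y ≥ ν) = (1−τ)·P(Y ≤ ν)`; in particular `P(Y ≤ ν) = τ`,
so `ν` is the `τ`-th quantile of `Y` (probabilities are integrals of `f`). -/
theorem stmt4 (f : ℝ → ℝ) (hf_nonneg : ∀ x, 0 ≤ f x) (hf_int : Integrable f)
    (hf_one : ∫ x, f x = 1) (τ ν : ℝ) (hτ : τ ∈ Set.Ioo (0:ℝ) 1)
    (hratio : ∀ᵐ x : ℝ, 0 < x → τ * f (ν + x) = (1 - τ) * f (ν - x)) :
    τ * ∫ x in Set.Ici ν, f x = (1 - τ) * ∫ x in Set.Iic ν, f x ∧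
    ∫ x in Set.Iic ν, f x = τ := by
  have hbalance : τ * ∫ x in Ici ν, f x = (1 - τ) * ∫ x in Iic ν, f x := by
    rw [← integral_Ioi_add_left_eq, ← integral_Ioi_sub_left_eq, ← integral_const_mul,
      ← integral_const_mul]
    exact setIntegral_congr_ae measurableSet_Ioi hratio
  refine ⟨hbalance, ?_⟩
  have htotal : (∫ x in Iic ν, f x) + ∫ x in Ici ν, f x = 1 := by
    rw [integral_Ici_eq_integral_Ioi, ← hf_one]
    exact intervalIntegral.integral_Iic_add_Ioi hf_int.integrableOn hf_int.integrableOn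
  linear_combination τ * htotal - hbalance
end

section
/- Let Y be an integrable real-valued random variable with probability density function f_Y, let τ∈(0,1) and ν_τ∈ℝ, and suppose τ·f_Y(ν_τ+x) = (1−τ)·f_Y(ν_τ−x) for almost every x>0. Then τ·E[(Y−ν_τ)₊] = (1−τ)·E[(ν_τ−Y)₊], where u₊ = max(u,0); in particular ν_τ is the τ-th expectile of Y. -/
open MeasureTheory Set

/-- If an integrable `Y` has pdf `f`, `τ ∈ (0,1)`, and
`τ·f(ν+x) = (1−τ)·f(ν−x)` for a.e. `x > 0`, then `τ·E[(Y−ν)₊] = (1−τ)·E[(ν−Y)₊]`,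
i.e. `ν` is the `τ`-th expectile of `Y` (expectations are integrals against `f`). -/
theorem stmt5 (f : ℝ → ℝ) (hf_nonneg : ∀ x, 0 ≤ f x) (hf_int : Integrable f)
    (hf_one : ∫ x, f x = 1) (hY_int : Integrable (fun x => x * f x))
    (τ ν : ℝ) (hτ : τ ∈ Set.Ioo (0:ℝ) 1)
    (hratio : ∀ᵐ x : ℝ, 0 < x → τ * f (ν + x) = (1 - τ) * f (ν - x)) :
    τ * ∫ x, max (x - ν) 0 * f x = (1 - τ) * ∫ x, max (ν - x) 0 * f x := by
  rw [← integral_add_left_eq_self (fun x => max (x - ν) 0 * f x) ν,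
    ← integral_sub_left_eq_self (fun x => max (ν - x) 0 * f x) volume ν,
    ← integral_const_mul, ← integral_const_mul]
  refine integral_congr_ae ?_
  filter_upwards [hratio] with x hx
  simp only [add_sub_cancel_left, sub_sub_cancel]
  rcases le_or_gt x 0 with h | h
  · simp [max_eq_right h]
  · rw [mul_left_comm, hx h, mul_left_comm]
end

section
/- Let f be the density of the Normal(μ,σ²) distribution, f(x) = (1/(σ√(2π)))·exp(−(x−μ)²/(2σ²)), let τ∈(0,1) and h₁,h₂>0. Then ν_τ = μ + (h₁−h₂)/2 − (σ²/(h₁+h₂))·ln((1−τ)/τ) is the unique real number θ satisfying the first-order modile equation τ·f(θ+h₂) = (1−τ)·f(θ−h₁). In particular, if h₁ = h₂ and τ = 1/2 then ν_τ = μ. -/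
open MeasureTheory Set

theorem mul_exp_eq_mul_exp_iff {a b x y : ℝ} (ha : 0 < a) (hb : 0 < b) :
    a * Real.exp x = b * Real.exp y ↔ x - y = Real.log (b / a) := by
  rw [← Real.exp_eq_exp (x := x - y), Real.exp_log (div_pos hb ha), Real.exp_sub,
    div_eq_div_iff (Real.exp_pos y).ne' ha.ne', mul_comm a]

/-- For the Normal(μ,σ²) density `f`, `τ ∈ (0,1)`, `h₁,h₂ > 0`,
`ν = μ + (h₁−h₂)/2 − (σ²/(h₁+h₂))·ln((1−τ)/τ)` is the unique `θ` with
`τ·f(θ+h₂) = (1−τ)·f(θ−h₁)`; if moreover `h₁ = h₂` and `τ = 1/2`, then `ν = μ`. -/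
theorem stmt6 (μ σ τ h₁ h₂ : ℝ) (hσ : 0 < σ) (hτ : τ ∈ Set.Ioo (0:ℝ) 1)
    (hh₁ : 0 < h₁) (hh₂ : 0 < h₂)
    (f : ℝ → ℝ)
    (hf : ∀ x, f x = (1 / (σ * Real.sqrt (2 * Real.pi))) *
      Real.exp (-(x - μ) ^ 2 / (2 * σ ^ 2)))
    (ν : ℝ)
    (hν : ν = μ + (h₁ - h₂) / 2 - (σ ^ 2 / (h₁ + h₂)) * Real.log ((1 - τ) / τ)) :
    τ * f (ν + h₂) = (1 - τ) * f (ν - h₁) ∧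
    (∀ θ : ℝ, τ * f (θ + h₂) = (1 - τ) * f (θ - h₁) → θ = ν) ∧
    (h₁ = h₂ → τ = 1 / 2 → ν = μ) := by
  obtain ⟨hτ0, hτ1⟩ := hτ
  have hτ1' : 0 < 1 - τ := sub_pos.mpr hτ1
  have hs : 0 < h₁ + h₂ := add_pos hh₁ hh₂
  have hc : 1 / (σ * Real.sqrt (2 * Real.pi)) ≠ 0 := by positivity
  have key : ∀ θ : ℝ, τ * f (θ + h₂) = (1 - τ) * f (θ - h₁) ↔ θ = ν := by
    intro θ
    rw [hf, hf, mul_left_comm, mul_left_comm (1 - τ), mul_right_inj' hc,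
      mul_exp_eq_mul_exp_iff hτ0 hτ1', hν]
    generalize Real.log ((1 - τ) / τ) = L
    have hdiff : -(θ + h₂ - μ) ^ 2 / (2 * σ ^ 2) - -(θ - h₁ - μ) ^ 2 / (2 * σ ^ 2) =
        (h₁ + h₂) / σ ^ 2 * (μ + (h₁ - h₂) / 2 - θ) := by
      field_simp
      ring
    have hL : L = (h₁ + h₂) / σ ^ 2 * (σ ^ 2 / (h₁ + h₂) * L) := by
      field_simp
    have hk : (h₁ + h₂) / σ ^ 2 ≠ 0 := by positivity
    rw [hdiff]
    nth_rewrite 1 [hL]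
    rw [mul_right_inj' hk]
    constructor <;> intro h <;> linarith
  refine ⟨(key ν).2 rfl, fun θ => (key θ).1, ?_⟩
  rintro rfl rfl
  rw [hν]
  norm_num
end

section
/- Let f be the density of the Laplace(μ,λ) distribution (λ>0), f(x) = (1/(2λ))·exp(−|x−μ|/λ), let τ∈(0,1) and h₁,h₂>0, and set ν_τ = μ + (h₁−h₂)/2 − (λ/2)·ln((1−τ)/τ). If min{h₁,h₂} ≥ |ν_τ−μ|, then τ·f(ν_τ+h₂) = (1−τ)·f(ν_τ−h₁), i.e. ν_τ satisfies the first-order modile equation. In particular, if h₁ = h₂ and τ = 1/2 then ν_τ = μ. -/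
open MeasureTheory Set

/-- For the Laplace(μ,λ) density `f(x) = (1/(2λ))·exp(−|x−μ|/λ)` (λ>0),
`τ ∈ (0,1)`, `h₁,h₂ > 0`, and `ν = μ + (h₁−h₂)/2 − (λ/2)·ln((1−τ)/τ)`: if
`min{h₁,h₂} ≥ |ν−μ|` then `τ·f(ν+h₂) = (1−τ)·f(ν−h₁)`; if moreover `h₁ = h₂` and
`τ = 1/2`, then `ν = μ`. -/
theorem stmt7 (μ lam τ h₁ h₂ : ℝ) (hlam : 0 < lam) (hτ : τ ∈ Set.Ioo (0:ℝ) 1)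
    (hh₁ : 0 < h₁) (hh₂ : 0 < h₂)
    (f : ℝ → ℝ)
    (hf : ∀ x, f x = (1 / (2 * lam)) * Real.exp (-|x - μ| / lam))
    (ν : ℝ)
    (hν : ν = μ + (h₁ - h₂) / 2 - (lam / 2) * Real.log ((1 - τ) / τ))
    (hside : min h₁ h₂ ≥ |ν - μ|) :
    τ * f (ν + h₂) = (1 - τ) * f (ν - h₁) ∧
    (h₁ = h₂ → τ = 1 / 2 → ν = μ) := by
  obtain ⟨hτ0, hτ1⟩ := hτ
  obtain ⟨hside₁, hside₂⟩ := le_min_iff.mp hside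
  refine ⟨?_, ?_⟩
  · have hright : |ν + h₂ - μ| = ν + h₂ - μ :=
      abs_of_nonneg (by linarith [(abs_le.mp hside₂).1])
    have hleft : |ν - h₁ - μ| = -(ν - h₁ - μ) :=
      abs_of_nonpos (by linarith [(abs_le.mp hside₁).2])
    have hexponent : -(ν + h₂ - μ) / lam =
        Real.log ((1 - τ) / τ) + -(-(ν - h₁ - μ)) / lam := by
      rw [hν]
      field_simp
      ring
    rw [hf, hf, hright, hleft, hexponent, Real.exp_add,
      Real.exp_log (div_pos (sub_pos.mpr hτ1) hτ0)]
    field_simp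
  · rintro rfl rfl
    norm_num [hν]
end

section
/- Let f be the density of the Gamma(α,β) distribution with α>1, β>0: f(x) = (β^α/Γ(α))·x^{α−1}·e^{−βx} for x>0. Let τ∈(0,1), h₁,h₂>0, set A = ((1−τ)/τ · exp(β(h₁+h₂)))^{1/(α−1)} and ν_τ = (A·h₁ + h₂)/(A−1). If A>1 and ν_τ > h₁, then τ·f(ν_τ+h₂) = (1−τ)·f(ν_τ−h₁), i.e. ν_τ satisfies the first-order modile equation. -/
open MeasureTheory Set

/-- For the Gamma(α,β) density `f(x) = (β^α/Γ(α))·x^(α−1)·e^(−βx)` on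
`x > 0` (α>1, β>0), `τ ∈ (0,1)`, `h₁,h₂ > 0`,
`A = ((1−τ)/τ · exp(β(h₁+h₂)))^(1/(α−1))` and `ν = (A·h₁+h₂)/(A−1)`: if `A > 1` and
`ν > h₁`, then `τ·f(ν+h₂) = (1−τ)·f(ν−h₁)`. -/
theorem stmt8 (α β τ h₁ h₂ : ℝ) (hα : 1 < α) (hβ : 0 < β) (hτ : τ ∈ Set.Ioo (0:ℝ) 1)
    (hh₁ : 0 < h₁) (hh₂ : 0 < h₂)
    (f : ℝ → ℝ)
    (hf : ∀ x, f x = if 0 < x then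
      (β ^ α / Real.Gamma α) * x ^ (α - 1) * Real.exp (-(β * x)) else 0)
    (A ν : ℝ)
    (hA : A = ((1 - τ) / τ * Real.exp (β * (h₁ + h₂))) ^ (1 / (α - 1)))
    (hν : ν = (A * h₁ + h₂) / (A - 1))
    (hA1 : 1 < A) (hνh : h₁ < ν) :
    τ * f (ν + h₂) = (1 - τ) * f (ν - h₁) := by
  obtain ⟨hτ0, hτ1⟩ := hτ
  have hlow : 0 < ν - h₁ := sub_pos.mpr hνh
  have hhigh : 0 < ν + h₂ := by linarith
  have hscale : ν + h₂ = A * (ν - h₁) := by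
    have h := (eq_div_iff (sub_pos.mpr hA1).ne').mp hν
    linarith
  have hbase : 0 ≤ (1 - τ) / τ * Real.exp (β * (h₁ + h₂)) :=
    mul_nonneg (div_nonneg (by linarith) hτ0.le) (Real.exp_pos _).le
  have hApow : A ^ (α - 1) = (1 - τ) / τ * Real.exp (β * (h₁ + h₂)) := by
    rw [hA, one_div, Real.rpow_inv_rpow hbase (by linarith)]
  have hpow : (ν + h₂) ^ (α - 1) =
      (1 - τ) / τ * Real.exp (β * (h₁ + h₂)) * (ν - h₁) ^ (α - 1) := by
    rw [hscale, Real.mul_rpow (by linarith) hlow.le, hApow]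
  have hexp : Real.exp (-(β * (ν - h₁))) =
      Real.exp (β * (h₁ + h₂)) * Real.exp (-(β * (ν + h₂))) := by
    rw [← Real.exp_add]
    ring_nf
  rw [hf, hf, if_pos hhigh, if_pos hlow, hpow, hexp]
  have hτ_cancel : τ * ((1 - τ) / τ) = 1 - τ := mul_div_cancel₀ _ hτ0.ne'
  linear_combination (β ^ α / Real.Gamma α * Real.exp (β * (h₁ + h₂)) *
    (ν - h₁) ^ (α - 1) * Real.exp (-(β * (ν + h₂)))) * hτ_cancel
end

section
/- Let f(y) = α·y^{−α−1} for y>1 (α>0) be the Pareto density, let τ∈(0,1), h₁,h₂>0, set A = ((1−τ)/τ)^{1/(α+1)} and ν_τ = (h₁ + A·h₂)/(1−A). If A<1 and ν_τ−h₁ > 1, then τ·f(ν_τ+h₂) = (1−τ)·f(ν_τ−h₁), i.e. ν_τ satisfies the first-order modile equation (this is equation (3.2) of the paper). -/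
open MeasureTheory Set

/-- For the Pareto density `f(y) = α·y^(−α−1)` on `y > 1` (α>0),
`τ ∈ (0,1)`, `h₁,h₂ > 0`, `A = ((1−τ)/τ)^(1/(α+1))` and `ν = (h₁ + A·h₂)/(1−A)`:
if `A < 1` and `ν−h₁ > 1`, then `τ·f(ν+h₂) = (1−τ)·f(ν−h₁)` (equation (3.2)). -/
theorem stmt12 (α τ h₁ h₂ : ℝ) (hα : 0 < α) (hτ : τ ∈ Set.Ioo (0:ℝ) 1)
    (hh₁ : 0 < h₁) (hh₂ : 0 < h₂)
    (f : ℝ → ℝ)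
    (hf : ∀ y, f y = if 1 < y then α * y ^ (-α - 1) else 0)
    (A ν : ℝ)
    (hA : A = ((1 - τ) / τ) ^ (1 / (α + 1)))
    (hν : ν = (h₁ + A * h₂) / (1 - A))
    (hA1 : A < 1) (hνh : 1 < ν - h₁) :
    τ * f (ν + h₂) = (1 - τ) * f (ν - h₁) := by
  obtain ⟨hτ0, hτ1⟩ := hτ
  have hτ1' : 0 < 1 - τ := sub_pos.2 hτ1
  have hr : 0 < (1 - τ) / τ := div_pos hτ1' hτ0
  have hA0 : 0 < A := hA ▸ Real.rpow_pos_of_pos hr _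
  have hy : 1 < ν + h₂ := by linarith
  have hscale : ν - h₁ = A * (ν + h₂) := by
    have hA1' : 1 - A ≠ 0 := (sub_pos.2 hA1).ne'
    rw [hν]
    field_simp
    ring
  have hpow : A ^ (-α - 1) = τ / (1 - τ) := by
    have hα1 : α + 1 ≠ 0 := by positivity
    have hexp : 1 / (α + 1) * (-α - 1) = -1 := by
      field_simp
      ring
    rw [hA, ← Real.rpow_mul hr.le, hexp, Real.rpow_neg_one, inv_div]
  rw [hf, hf, if_pos hy, if_pos hνh, hscale, Real.mul_rpow hA0.le (by linarith), hpow]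
  field_simp
end

section
/- Fix α>0 and h₁,h₂>0, and for τ∈(0,1) let ν_τ = (h₁ + A_τ·h₂)/(1−A_τ) with A_τ = ((1−τ)/τ)^{1/(α+1)} be the Pareto modile, and let q_τ = (1−τ)^{−1/α} be the Pareto τ-quantile. Then ν_τ → h₁ (a finite limit) as τ → 1⁻, while q_τ → +∞ as τ → 1⁻; consequently ν_τ < q_τ for all τ sufficiently close to 1. -/
open MeasureTheory Set Filter

/-- For fixed `α > 0`, `h₁,h₂ > 0`, the Pareto modile
`ν_τ = (h₁ + A_τ·h₂)/(1−A_τ)` with `A_τ = ((1−τ)/τ)^(1/(α+1))` tends to the finite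
limit `h₁` as `τ → 1⁻`, while the Pareto quantile `q_τ = (1−τ)^(−1/α)` tends to `+∞`
as `τ → 1⁻`; consequently `ν_τ < q_τ` for all `τ` sufficiently close to `1`. -/
theorem stmt13 (α h₁ h₂ : ℝ) (hα : 0 < α) (hh₁ : 0 < h₁) (hh₂ : 0 < h₂)
    (A ν q : ℝ → ℝ)
    (hA : ∀ τ, A τ = ((1 - τ) / τ) ^ (1 / (α + 1)))
    (hν : ∀ τ, ν τ = (h₁ + A τ * h₂) / (1 - A τ))
    (hq : ∀ τ, q τ = (1 - τ) ^ (-(1 / α))) :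
    Tendsto ν (nhdsWithin 1 (Set.Iio 1)) (nhds h₁) ∧
    Tendsto q (nhdsWithin 1 (Set.Iio 1)) atTop ∧
    (∀ᶠ τ in nhdsWithin 1 (Set.Iio 1), ν τ < q τ) := by
  have hA_lim : Tendsto A (nhdsWithin 1 (Set.Iio 1)) (nhds 0) := by
    have hp : 0 < 1 / (α + 1) := by positivity
    have hcont : ContinuousAt (fun τ : ℝ => ((1 - τ) / τ) ^ (1 / (α + 1))) 1 :=
      ((continuousAt_const.sub continuousAt_id).div continuousAt_id one_ne_zero).rpow_const
        (Or.inr hp.le)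
    have hlim := hcont.tendsto.mono_left (nhdsWithin_le_nhds (s := Set.Iio 1))
    simp only [sub_self, zero_div, Real.zero_rpow hp.ne'] at hlim
    exact hlim.congr fun τ => (hA τ).symm
  have hν_lim : Tendsto ν (nhdsWithin 1 (Set.Iio 1)) (nhds h₁) := by
    have hlim := ((hA_lim.mul_const h₂).const_add h₁).div (hA_lim.const_sub 1) (by norm_num)
    simp only [zero_mul, add_zero, sub_zero, div_one] at hlim
    exact hlim.congr fun τ => (hν τ).symm
  have hq_lim : Tendsto q (nhdsWithin 1 (Set.Iio 1)) atTop := by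
    have hsub : Tendsto (fun τ : ℝ => 1 - τ) (nhdsWithin 1 (Set.Iio 1))
        (nhdsWithin 0 (Set.Ioi 0)) := by
      refine tendsto_nhdsWithin_iff.2 ⟨?_, ?_⟩
      · have hcont : Continuous fun τ : ℝ => 1 - τ := by fun_prop
        simpa using (hcont.tendsto 1).mono_left (nhdsWithin_le_nhds (s := Set.Iio 1))
      · filter_upwards [self_mem_nhdsWithin] with τ hτ using sub_pos.2 (mem_Iio.1 hτ)
    exact ((tendsto_rpow_neg_nhdsGT_zero (neg_lt_zero.2 (one_div_pos.2 hα))).comp hsub).congr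
      fun τ => (hq τ).symm
  refine ⟨hν_lim, hq_lim, ?_⟩
  filter_upwards [hν_lim.eventually_lt_const (lt_add_one h₁),
    hq_lim.eventually_ge_atTop (h₁ + 1)] with τ hντ hqτ using hντ.trans_le hqτ
end
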